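/- arXiv:2405.15990 — 3 statements merged into one kernel-verified Lean document; each statement's English description precedes it below -/
import Mathlib

section
/- Let X, F, J, δ, L and the VIJI iterates (x_k, v_k, s_k, λ_k) with η = 10 be as in the context, and assume additionally that F is monotone on X and that a weak solution x* of the variational inequality exists. Let D be the diameter of X and define the weighted average x̃_T = (∑_{k=1}^T λ_k x_k)/(∑_{k=1}^T λ_k). Then for every integer T ≥ 1, the gap function satisfies gap(x̃_T) = sup_{x ∈ X} ⟨F(x), x̃_T − x⟩ ≤ 16√2 · L D³ / T^{3/2} + 16√2 · δ D² / T. -/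
open scoped RealInnerProductSpace

section

variable {E : Type*} [NormedAddCommGroup E] [InnerProductSpace ℝ E]

/-- Second-order Taylor remainder on a convex set where the derivative is `L`-Lipschitz. -/
lemma norm_taylor_remainder_le {X : Set E} (hX : Convex ℝ X) {F : E → E} {F' : E → E →L[ℝ] E}
    (hF' : ∀ x, HasFDerivAt F (F' x) x) {L : ℝ}
    (hsmooth : ∀ x ∈ X, ∀ y ∈ X, ‖F' x - F' y‖ ≤ L * ‖x - y‖)
    {v x : E} (hv : v ∈ X) (hx : x ∈ X) :
    ‖F x - F v - F' v (x - v)‖ ≤ L / 2 * ‖x - v‖ ^ 2 := by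
  have hg : ∀ t : ℝ, HasDerivAt
      (fun t : ℝ => F (v + t • (x - v)) - F v - t • F' v (x - v))
      (F' (v + t • (x - v)) (x - v) - F' v (x - v)) t := by
    intro t
    have hline : HasDerivAt (fun t : ℝ => v + t • (x - v)) (x - v) t := by
      simpa using ((hasDerivAt_id t).smul_const (x - v)).const_add v
    have hlin : HasDerivAt (fun t : ℝ => t • F' v (x - v)) (F' v (x - v)) t := by
      simpa using (hasDerivAt_id t).smul_const (F' v (x - v))
    exact (((hF' _).comp_hasDerivAt t hline).sub_const (F v)).sub hlin
  have hB : ∀ t : ℝ, HasDerivAt (fun t : ℝ => L / 2 * ‖x - v‖ ^ 2 * t ^ 2)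
      (L * ‖x - v‖ ^ 2 * t) t := by
    intro t
    refine ((hasDerivAt_pow 2 t).const_mul (L / 2 * ‖x - v‖ ^ 2)).congr_deriv ?_
    norm_num
    ring
  have key := image_norm_le_of_norm_deriv_right_le_deriv_boundary (a := 0) (b := 1)
    (fun t _ => (hg t).continuousAt.continuousWithinAt)
    (fun t _ => (hg t).hasDerivWithinAt) (B := fun t : ℝ => L / 2 * ‖x - v‖ ^ 2 * t ^ 2)
    (by simp) hB
    (by
      rintro t ⟨ht0, ht1⟩
      have hmem : v + t • (x - v) ∈ X := hX.add_smul_sub_mem hv hx ⟨ht0, ht1.le⟩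
      rw [← sub_apply]
      calc ‖(F' (v + t • (x - v)) - F' v) (x - v)‖
          ≤ ‖F' (v + t • (x - v)) - F' v‖ * ‖x - v‖ := ContinuousLinearMap.le_opNorm _ _
        _ ≤ L * ‖v + t • (x - v) - v‖ * ‖x - v‖ := by gcongr; exact hsmooth _ hmem _ hv
        _ = L * ‖x - v‖ ^ 2 * t := by
            rw [add_sub_cancel_left, norm_smul, Real.norm_of_nonneg ht0]; ring)
    (Set.right_mem_Icc.mpr zero_le_one)
  simpa using key

/-- Quadratic growth at the maximiser over a convex set of `w ↦ ⟪s, w - c⟫ - ‖w - c‖² / 2`. -/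
lemma add_half_sq_norm_le_of_isMax {X : Set E} (hX : Convex ℝ X) {s c v : E} (hv : v ∈ X)
    (hmax : ∀ w ∈ X, ⟪s, w - c⟫ - 1 / 2 * ‖w - c‖ ^ 2 ≤ ⟪s, v - c⟫ - 1 / 2 * ‖v - c‖ ^ 2)
    {w : E} (hw : w ∈ X) :
    ⟪s, w - c⟫ - 1 / 2 * ‖w - c‖ ^ 2 + 1 / 2 * ‖w - v‖ ^ 2 ≤
      ⟪s, v - c⟫ - 1 / 2 * ‖v - c‖ ^ 2 := by
  have hexp : ∀ t : ℝ, ⟪s, v + t • (w - v) - c⟫ - 1 / 2 * ‖v + t • (w - v) - c‖ ^ 2 =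
      ⟪s, v - c⟫ - 1 / 2 * ‖v - c‖ ^ 2
        + t * (⟪s, w - v⟫ - ⟪v - c, w - v⟫) - t ^ 2 / 2 * ‖w - v‖ ^ 2 := by
    intro t
    have h : v + t • (w - v) - c = (v - c) + t • (w - v) := by abel
    rw [h, norm_add_sq_real, inner_add_right, real_inner_smul_right, real_inner_smul_right,
      norm_smul, mul_pow, Real.norm_eq_abs, sq_abs]
    ring
  have hfirst : ⟪s, w - v⟫ - ⟪v - c, w - v⟫ ≤ 0 := by
    by_contra! hpos
    set a := ⟪s, w - v⟫ - ⟪v - c, w - v⟫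
    have hle : ∀ t ∈ Set.Ioc (0 : ℝ) 1, a ≤ t / 2 * ‖w - v‖ ^ 2 := by
      rintro t ⟨ht0, ht1⟩
      have h := hmax _ (hX.add_smul_sub_mem hv hw ⟨ht0.le, ht1⟩)
      rw [hexp] at h
      refine le_of_mul_le_mul_left ?_ ht0
      linarith
    have hden : 0 < a + ‖w - v‖ ^ 2 := by positivity
    have h := hle (a / (a + ‖w - v‖ ^ 2))
      ⟨by positivity, by rw [div_le_one hden]; linarith [sq_nonneg ‖w - v‖]⟩
    rw [div_div, div_mul_eq_mul_div, le_div_iff₀ (by positivity)] at h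
    nlinarith [mul_pos hpos hpos, mul_nonneg hpos.le (sq_nonneg ‖w - v‖)]
  have h1 := hexp 1
  rw [one_smul, add_sub_cancel] at h1
  linarith

/-- If `lam⁻¹` is between `22` and `32` times the model accuracy `a`, then for an inexact
solution `x` of the regularised model at `v` the step length `‖v' - v‖` controls the extragradient error. -/
lemma extragradient_error_le {x v v' f Ω e : E} {a lam : ℝ} (ha : 0 ≤ a) (hlam0 : 0 ≤ lam)
    (hlow : 1 / 32 ≤ lam * a) (hup : lam * a ≤ 1 / 22)
    (hf : f = Ω + e - (10 * a) • (x - v)) (he : ‖e‖ ≤ a * ‖x - v‖)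
    (hsub : ⟪Ω, x - v'⟫ ≤ a * ‖x - v‖ ^ 2) :
    lam * ⟪f, x - v'⟫ + 1 / 8 * ‖x - v‖ ^ 2 ≤ 1 / 2 * ‖v' - v‖ ^ 2 := by
  have hdec : x - v' = (x - v) - (v' - v) := by abel
  have hfe : ⟪f, x - v'⟫ = ⟪Ω, x - v'⟫ + ⟪e, x - v'⟫
      - 10 * a * (‖x - v‖ ^ 2 - ⟪x - v, v' - v⟫) := by
    rw [hf, inner_sub_left, inner_add_left, real_inner_smul_left]
    congr 2
    rw [hdec, inner_sub_right, real_inner_self_eq_norm_sq]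
  have he' : ⟪e, x - v'⟫ ≤ a * ‖x - v‖ * (‖x - v‖ + ‖v' - v‖) :=
    calc ⟪e, x - v'⟫ ≤ ‖e‖ * ‖x - v'‖ := real_inner_le_norm _ _
      _ ≤ a * ‖x - v‖ * (‖x - v‖ + ‖v' - v‖) := by
        gcongr
        rw [hdec]
        exact norm_sub_le _ _
  have hc := real_inner_le_norm (x - v) (v' - v)
  set r := ‖x - v‖
  set q := ‖v' - v‖
  have hbound : ⟪f, x - v'⟫ ≤ a * (11 * (r * q) - 8 * r ^ 2) := by
    rw [hfe]
    nlinarith [mul_le_mul_of_nonneg_left hc ha]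
  have h1 := mul_le_mul_of_nonneg_left hbound hlam0
  rw [← mul_assoc] at h1
  have h2 : 1 / 32 * r ^ 2 ≤ lam * a * r ^ 2 := by gcongr
  have h3 : 11 * (lam * a * (r * q)) ≤ 121 / 2 * (lam * a) ^ 2 * r ^ 2 + 1 / 2 * q ^ 2 := by
    nlinarith [sq_nonneg (11 * (lam * a) * r - q)]
  have h4 : (lam * a) ^ 2 * r ^ 2 ≤ 1 / 22 * (lam * a * r ^ 2) := by
    have := mul_le_mul_of_nonneg_right hup (by positivity : 0 ≤ lam * a * r ^ 2)
    linarith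
  linarith [sq_nonneg r]

end

/-- Lower bound on the total step size when each `λ_k (L r_k / 2 + δ)` is at least `1 / 32`. -/
lemma sq_card_le_sum_mul {ι : Type*} {I : Finset ι} {lam r : ι → ℝ} {L δ B : ℝ} (hL : 0 ≤ L)
    (hB : 0 ≤ B) (hlam : ∀ k ∈ I, 0 < lam k)
    (hlow : ∀ k ∈ I, 1 / 32 ≤ lam k * (L / 2 * r k + δ))
    (hr : ∑ k ∈ I, r k ^ 2 ≤ B ^ 2) :
    (I.card : ℝ) ^ 2 ≤
      (∑ k ∈ I, lam k) * (32 * (L / 2 * (B * √I.card) + δ * I.card)) := by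
  have hcs : (∑ k ∈ I, (1 : ℝ)) ^ 2 ≤
      (∑ k ∈ I, lam k) * ∑ k ∈ I, 32 * (L / 2 * r k + δ) := by
    refine Finset.sum_sq_le_sum_mul_sum_of_sq_le_mul I (fun k hk => (hlam k hk).le) ?_ ?_
    · intro k hk
      have : 0 < L / 2 * r k + δ :=
        pos_of_mul_pos_right (by linarith [hlow k hk]) (hlam k hk).le
      positivity
    · intro k hk
      linarith [hlow k hk]
  have hsum : ∑ k ∈ I, r k ≤ B * √I.card := by
    refine le_of_sq_le_sq ?_ (by positivity)
    rw [mul_pow, Real.sq_sqrt (Nat.cast_nonneg _)]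
    have h1 : (∑ k ∈ I, r k) ^ 2 ≤ I.card * ∑ k ∈ I, r k ^ 2 := sq_sum_le_card_mul_sum_sq
    have h2 := mul_le_mul_of_nonneg_left hr (Nat.cast_nonneg (α := ℝ) I.card)
    linarith
  rw [← Finset.mul_sum, Finset.sum_add_distrib, ← Finset.mul_sum] at hcs
  simp only [Finset.sum_const, nsmul_eq_mul, mul_one] at hcs
  refine hcs.trans ?_
  have hS : 0 ≤ ∑ k ∈ I, lam k := Finset.sum_nonneg fun k hk => (hlam k hk).le
  rw [mul_comm δ]
  gcongr

/-- Theorem 3.1: convergence of VIJI in the monotone case, η = 10, opt = 0: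
for the weighted average `x̃_T = (∑ λ_k x_k)/(∑ λ_k)`,
`gap(x̃_T) = sup_{x ∈ X} ⟪F(x), x̃_T − x⟫ ≤ 16√2 L D³ / T^{3/2} + 16√2 δ D² / T`. -/
theorem viji_monotone_convergence
    (d : ℕ) (X : Set (EuclideanSpace ℝ (Fin d)))
    (hXconv : Convex ℝ X) (hXclosed : IsClosed X) (hXbdd : Bornology.IsBounded X)
    (F : EuclideanSpace ℝ (Fin d) → EuclideanSpace ℝ (Fin d))
    (F' : EuclideanSpace ℝ (Fin d) → EuclideanSpace ℝ (Fin d) →L[ℝ] EuclideanSpace ℝ (Fin d))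
    (hF' : ∀ x, HasFDerivAt F (F' x) x)
    (L δ : ℝ)
    (hsmooth : ∀ x ∈ X, ∀ y ∈ X, ‖F' x - F' y‖ ≤ L * ‖x - y‖)
    (J : EuclideanSpace ℝ (Fin d) → EuclideanSpace ℝ (Fin d) →L[ℝ] EuclideanSpace ℝ (Fin d))
    (hJ : ∀ v ∈ X, ‖F' v - J v‖ ≤ δ)
    (Ω : EuclideanSpace ℝ (Fin d) → EuclideanSpace ℝ (Fin d) → EuclideanSpace ℝ (Fin d))
    (hΩ : ∀ v x, Ω v x = F v + J v (x - v) + (10 * δ) • (x - v)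
      + (5 * L * ‖x - v‖) • (x - v))
    (xs vs s : ℕ → EuclideanSpace ℝ (Fin d)) (lam : ℕ → ℝ)
    (hxsX : ∀ k, xs k ∈ X) (hvsX : ∀ k, vs k ∈ X)
    (hs0 : s 0 = 0)
    (hlampos : ∀ k, 0 < lam k)
    (hvmax : ∀ k, ∀ w ∈ X,
      ⟪s k, w - xs 0⟫ - 1 / 2 * ‖w - xs 0‖ ^ 2 ≤
        ⟪s k, vs (k + 1) - xs 0⟫ - 1 / 2 * ‖vs (k + 1) - xs 0‖ ^ 2)
    (hsub : ∀ k, ∀ w ∈ X,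
      ⟪Ω (vs (k + 1)) (xs (k + 1)), xs (k + 1) - w⟫ ≤
        L / 2 * ‖xs (k + 1) - vs (k + 1)‖ ^ 3 + δ * ‖xs (k + 1) - vs (k + 1)‖ ^ 2)
    (hlam : ∀ k, 1 / 32 ≤ lam (k + 1) * (L / 2 * ‖xs (k + 1) - vs (k + 1)‖ + δ) ∧
      lam (k + 1) * (L / 2 * ‖xs (k + 1) - vs (k + 1)‖ + δ) ≤ 1 / 22)
    (hsrec : ∀ k, s (k + 1) = s k - lam (k + 1) • F (xs (k + 1)))
    (hmono : ∀ x ∈ X, ∀ y ∈ X, 0 ≤ ⟪F x - F y, x - y⟫)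
    (xstar : EuclideanSpace ℝ (Fin d)) (hxstarX : xstar ∈ X)
    (hweak : ∀ x ∈ X, 0 ≤ ⟪F x, x - xstar⟫)
    (D : ℝ) (hD : Metric.diam X = D) :
    ∀ T : ℕ, 1 ≤ T →
      sSup ((fun w =>
          ⟪F w, ((∑ k ∈ Finset.Icc 1 T, lam k)⁻¹ •
            ∑ k ∈ Finset.Icc 1 T, lam k • xs k) - w⟫) '' X) ≤
        16 * Real.sqrt 2 * L * D ^ 3 / (T : ℝ) ^ ((3 : ℝ) / 2)
          + 16 * Real.sqrt 2 * δ * D ^ 2 / (T : ℝ) := by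
  have hδ : 0 ≤ δ := (norm_nonneg _).trans (hJ _ hxstarX)
  have hdist : ∀ x ∈ X, ∀ y ∈ X, ‖x - y‖ ≤ D := fun x hx y hy => by
    rw [← hD, ← dist_eq_norm]
    exact Metric.dist_le_diam_of_mem hXbdd hx hy
  have hD0 : 0 ≤ D := hD ▸ Metric.diam_nonneg
  have hpot : ∀ k, lam (k + 1) * ⟪F (xs (k + 1)), xs (k + 1) - vs (k + 2)⟫
      + 1 / 8 * ‖xs (k + 1) - vs (k + 1)‖ ^ 2 ≤ 1 / 2 * ‖vs (k + 2) - vs (k + 1)‖ ^ 2 := by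
    intro k
    set x := xs (k + 1)
    set v := vs (k + 1)
    have hx : x ∈ X := hxsX _
    have hv : v ∈ X := hvsX _
    refine extragradient_error_le (a := L / 2 * ‖x - v‖ + δ)
      (e := (F x - F v - F' v (x - v)) + (F' v - J v) (x - v)) (Ω := Ω v x)
      ?_ (hlampos _).le (hlam k).1 (hlam k).2 ?_ ?_ ?_
    · exact (pos_of_mul_pos_right (by linarith [(hlam k).1]) (hlampos (k + 1)).le).le
    · rw [hΩ, sub_apply]
      module
    · calc _ ≤ ‖F x - F v - F' v (x - v)‖ + ‖(F' v - J v) (x - v)‖ := norm_add_le _ _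
        _ ≤ L / 2 * ‖x - v‖ ^ 2 + δ * ‖x - v‖ := by
          gcongr
          · exact norm_taylor_remainder_le hXconv hF' hsmooth hv hx
          · exact (F' v - J v).le_of_opNorm_le (hJ v hv) _
        _ = _ := by ring
    · refine (hsub k _ (hvsX (k + 2))).trans_eq ?_
      ring
  have hregret : ∀ w ∈ X, ∀ T : ℕ, ∑ k ∈ Finset.Icc 1 T,
      (lam k * ⟪F (xs k), xs k - w⟫ + 1 / 8 * ‖xs k - vs k‖ ^ 2) ≤ 1 / 2 * D ^ 2 := by
    intro w hw T
    have hsum : ∑ k ∈ Finset.Icc 1 T,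
        (lam k * ⟪F (xs k), xs k - w⟫ + 1 / 8 * ‖xs k - vs k‖ ^ 2) ≤
        ⟪s T, w - xs 0⟫ -
          (⟪s T, vs (T + 1) - xs 0⟫ - 1 / 2 * ‖vs (T + 1) - xs 0‖ ^ 2) := by
      induction T with
      | zero =>
        simp only [hs0, inner_zero_left, Finset.Icc_eq_empty_of_lt zero_lt_one,
          Finset.sum_empty]
        linarith [sq_nonneg ‖vs (0 + 1) - xs 0‖]
      | succ k ih =>
        rw [Finset.sum_Icc_succ_top (by omega)]
        have hgrow := add_half_sq_norm_le_of_isMax hXconv (hvsX (k + 1)) (hvmax k)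
          (hvsX (k + 2))
        have hp := hpot k
        rw [hsrec k, inner_sub_left, inner_sub_left, real_inner_smul_left,
          real_inner_smul_left]
        have e1 : xs (k + 1) - w = (xs (k + 1) - xs 0) - (w - xs 0) := by abel
        have e2 : xs (k + 1) - vs (k + 2) =
          (xs (k + 1) - xs 0) - (vs (k + 2) - xs 0) := by abel
        rw [e2, inner_sub_right] at hp
        rw [e1, inner_sub_right]
        linarith
    have h1 := hvmax T w hw
    have h2 : ‖w - xs 0‖ ^ 2 ≤ D ^ 2 := by
      gcongr
      exact hdist _ hw _ (hxsX 0)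
    linarith
  intro T hT
  set S := ∑ k ∈ Finset.Icc 1 T, lam k
  have hS : 0 < S := Finset.sum_pos (fun k _ => hlampos k) ⟨1, by simpa using hT⟩
  have hsq : ∑ k ∈ Finset.Icc 1 T, ‖xs k - vs k‖ ^ 2 ≤ (2 * D) ^ 2 := by
    have h := hregret xstar hxstarX T
    rw [Finset.sum_add_distrib, ← Finset.mul_sum] at h
    have hnn : 0 ≤ ∑ k ∈ Finset.Icc 1 T, lam k * ⟪F (xs k), xs k - xstar⟫ :=
      Finset.sum_nonneg fun k _ => mul_nonneg (hlampos k).le (hweak _ (hxsX k))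
    linarith
  have hgap : ∀ w ∈ X,
      ⟪F w, (S⁻¹ • ∑ k ∈ Finset.Icc 1 T, lam k • xs k) - w⟫ ≤ D ^ 2 / (2 * S) := by
    intro w hw
    have heq : (S⁻¹ • ∑ k ∈ Finset.Icc 1 T, lam k • xs k) - w =
        S⁻¹ • ∑ k ∈ Finset.Icc 1 T, lam k • (xs k - w) := by
      simp only [smul_sub, Finset.sum_sub_distrib, ← Finset.sum_smul]
      rw [inv_smul_smul₀ hS.ne']
    have hle : ∑ k ∈ Finset.Icc 1 T, ⟪F w, lam k • (xs k - w)⟫ ≤ 1 / 2 * D ^ 2 := by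
      refine (Finset.sum_le_sum fun k _ => ?_).trans (hregret w hw T)
      have hm := hmono _ (hxsX k) w hw
      rw [inner_sub_left, sub_nonneg] at hm
      rw [real_inner_smul_right]
      have := mul_le_mul_of_nonneg_left hm (hlampos k).le
      linarith [sq_nonneg ‖xs k - vs k‖]
    rw [heq, real_inner_smul_right, inner_sum, inv_mul_le_iff₀ hS]
    refine hle.trans_eq ?_
    field_simp
  have hTpos : (0 : ℝ) < T := by exact_mod_cast hT
  refine (csSup_le (Set.Nonempty.image _ ⟨xstar, hxstarX⟩) (a := D ^ 2 / (2 * S)) ?_).trans ?_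
  · rintro _ ⟨w, hw, rfl⟩
    exact hgap w hw
  rcases hD0.eq_or_lt with hDz | hDpos
  · simp [← hDz]
  have hL : 0 ≤ L := by
    by_contra! hneg
    have hsub' : X.Subsingleton := fun x hx y hy => by
      by_contra hne
      have h1 := (norm_nonneg _).trans (hsmooth x hx y hy)
      exact absurd h1 (not_le.mpr (mul_neg_of_neg_of_pos hneg (norm_sub_pos_iff.mpr hne)))
    exact hDpos.ne' (hD ▸ Metric.diam_subsingleton hsub')
  have hcard := sq_card_le_sum_mul (I := Finset.Icc 1 T) (lam := lam)
    (r := fun k => ‖xs k - vs k‖) (δ := δ) hL (by positivity : 0 ≤ 2 * D)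
    (fun k _ => hlampos k)
    (fun k hk => by
      obtain ⟨j, rfl⟩ := Nat.exists_eq_add_of_le' (Finset.mem_Icc.mp hk).1
      exact (hlam j).1) hsq
  rw [Nat.card_Icc, Nat.add_sub_cancel] at hcard
  have hpow : (T : ℝ) ^ ((3 : ℝ) / 2) = T * √T := by
    rw [show (3 : ℝ) / 2 = 1 + 1 / 2 by norm_num, Real.rpow_add hTpos, Real.rpow_one,
      ← Real.sqrt_eq_rpow]
  have hsqrtT : 0 < √(T : ℝ) := Real.sqrt_pos.mpr hTpos
  have hone : (1 : ℝ) ≤ √2 := Real.one_le_sqrt.mpr one_le_two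
  calc D ^ 2 / (2 * S) ≤ 16 * D ^ 2 * (L * D * √T + δ * T) / (T : ℝ) ^ 2 := by
        rw [div_le_div_iff₀ (by positivity) (by positivity)]
        have := mul_le_mul_of_nonneg_left hcard (sq_nonneg D)
        linarith
    _ = 16 * 1 * L * D ^ 3 / (T * √T) + 16 * 1 * δ * D ^ 2 / T := by
        have hs : √(T : ℝ) ^ 2 = T := Real.sq_sqrt hTpos.le
        field_simp
        linear_combination D * L * hs
    _ ≤ _ := by
        rw [hpow]
        gcongr
end

section
/- Let X, F, J, δ, L and the VIJI iterates (x_k, v_k, s_k, λ_k) with η = 10 be as in the context, and assume F satisfies the Minty condition on X with point x*. Let D be the diameter of X and let k_T = argmin_{1 ≤ k ≤ T} ∥x_k − v_k∥. Then for every integer T ≥ 1, the residue function satisfies res(x_{k_T}) = sup_{x ∈ X} ⟨F(x_{k_T}), x_{k_T} − x⟩ ≤ 14 L D³ / T + 24 δ D² / √T. -/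
open scoped RealInnerProductSpace

section Helpers

variable {E : Type*} [NormedAddCommGroup E] [InnerProductSpace ℝ E]

/-- The remainder of the first-order Taylor expansion along a segment is quadratic when the
derivative is Lipschitz on a convex set. -/
lemma norm_sub_sub_fderiv_le_of_lipschitz {X : Set E} (hX : Convex ℝ X) {F : E → E}
    {F' : E → E →L[ℝ] E} (hF' : ∀ x, HasFDerivAt F (F' x) x) {L : ℝ}
    (hL : ∀ x ∈ X, ∀ y ∈ X, ‖F' x - F' y‖ ≤ L * ‖x - y‖) {x v : E} (hx : x ∈ X) (hv : v ∈ X) :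
    ‖F x - F v - F' v (x - v)‖ ≤ L / 2 * ‖x - v‖ ^ 2 := by
  have hγ (t : ℝ) : HasDerivAt (fun t : ℝ => v + t • (x - v)) (x - v) t := by
    simpa using ((hasDerivAt_id t).smul_const (x - v)).const_add v
  have hf (t : ℝ) : HasDerivAt (fun t : ℝ => F (v + t • (x - v)) - F v - t • F' v (x - v))
      (F' (v + t • (x - v)) (x - v) - F' v (x - v)) t := by
    have h1 := ((hF' (v + t • (x - v))).comp_hasDerivAt t (hγ t)).sub_const (F v)
    have h2 : HasDerivAt (fun t : ℝ => t • F' v (x - v)) (F' v (x - v)) t := by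
      simpa using (hasDerivAt_id t).smul_const (F' v (x - v))
    exact h1.sub h2
  have hB (t : ℝ) : HasDerivAt (fun t : ℝ => L / 2 * ‖x - v‖ ^ 2 * t ^ 2)
      (L * ‖x - v‖ ^ 2 * t) t := by
    refine ((hasDerivAt_pow 2 t).const_mul (L / 2 * ‖x - v‖ ^ 2)).congr_deriv ?_
    norm_num
    ring
  have key := image_norm_le_of_norm_deriv_right_le_deriv_boundary
    (a := (0 : ℝ)) (b := 1) (fun t _ => (hf t).continuousAt.continuousWithinAt)
    (fun t _ => (hf t).hasDerivWithinAt) (by simp) hB ?_ (x := 1) (by simp)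
  · simpa using key
  · intro t ht
    have hmem : v + t • (x - v) ∈ X := hX.add_smul_sub_mem hv hx ⟨ht.1, ht.2.le⟩
    rw [← sub_apply]
    refine (ContinuousLinearMap.le_opNorm _ _).trans ?_
    have h := hL _ hmem v hv
    rw [add_sub_cancel_left, norm_smul, Real.norm_of_nonneg ht.1] at h
    calc _ ≤ L * (t * ‖x - v‖) * ‖x - v‖ := by gcongr
      _ = _ := by ring

/-- A maximizer of `w ↦ ⟪s, w - x₀⟫ - ‖w - x₀‖² / 2` over a convex set exceeds every other value
by the quadratic gap of strong concavity. -/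
lemma inner_sub_half_norm_sq_add_le_of_isMax {X : Set E} (hX : Convex ℝ X) {s x₀ v : E}
    (hv : v ∈ X)
    (hmax : ∀ w ∈ X, ⟪s, w - x₀⟫ - 1 / 2 * ‖w - x₀‖ ^ 2 ≤ ⟪s, v - x₀⟫ - 1 / 2 * ‖v - x₀‖ ^ 2)
    {w : E} (hw : w ∈ X) :
    ⟪s, w - x₀⟫ - 1 / 2 * ‖w - x₀‖ ^ 2 + 1 / 2 * ‖w - v‖ ^ 2 ≤
      ⟪s, v - x₀⟫ - 1 / 2 * ‖v - x₀‖ ^ 2 := by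
  have expand (t : ℝ) : ⟪s, v + t • (w - v) - x₀⟫ - 1 / 2 * ‖v + t • (w - v) - x₀‖ ^ 2 =
      ⟪s, v - x₀⟫ - 1 / 2 * ‖v - x₀‖ ^ 2 + t * (⟪s, w - v⟫ - ⟪v - x₀, w - v⟫)
        - t ^ 2 / 2 * ‖w - v‖ ^ 2 := by
    have h : v + t • (w - v) - x₀ = (v - x₀) + t • (w - v) := by abel
    rw [h, norm_add_sq_real, inner_add_right, inner_smul_right, inner_smul_right, norm_smul,
      mul_pow, Real.norm_eq_abs, sq_abs]
    ring
  have hle : ⟪s, w - v⟫ - ⟪v - x₀, w - v⟫ ≤ 0 := by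
    by_contra! hc
    set c := ⟪s, w - v⟫ - ⟪v - x₀, w - v⟫
    have hn : 0 ≤ ‖w - v‖ ^ 2 := by positivity
    set n := ‖w - v‖ ^ 2
    have ht : 0 < c / (c + n) := by positivity
    have ht1 : c / (c + n) ≤ 1 := by rw [div_le_one (by positivity)]; linarith
    have h := hmax _ (hX.add_smul_sub_mem hv hw ⟨ht.le, ht1⟩)
    rw [expand] at h
    have htm : c / (c + n) * (c + n) = c := div_mul_cancel₀ _ (by positivity)
    generalize c / (c + n) = t at *
    nlinarith [mul_pos ht hc]
  have h := expand 1
  rw [one_smul, add_sub_cancel] at h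
  linarith

/-- Regularizing an inexact first-order model controls the operator itself. -/
lemma inner_le_of_inexact_model {X : Set E} (hX : Convex ℝ X) {F : E → E}
    {F' J : E → E →L[ℝ] E} (hF' : ∀ x, HasFDerivAt F (F' x) x) {L δ : ℝ}
    (hL : ∀ x ∈ X, ∀ y ∈ X, ‖F' x - F' y‖ ≤ L * ‖x - y‖)
    (hJ : ∀ v ∈ X, ‖F' v - J v‖ ≤ δ) {x v w : E} (hx : x ∈ X) (hv : v ∈ X)
    (hsub : ⟪F v + J v (x - v) + (10 * δ) • (x - v) + (5 * L * ‖x - v‖) • (x - v), x - w⟫ ≤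
      L / 2 * ‖x - v‖ ^ 3 + δ * ‖x - v‖ ^ 2) :
    ⟪F x, x - w⟫ ≤ (L / 2 * ‖x - v‖ + δ) *
      (‖x - v‖ ^ 2 + ‖x - v‖ * ‖x - w‖ - 10 * ⟪x - v, x - w⟫) := by
  have herr : ‖F x - F v - J v (x - v)‖ ≤ (L / 2 * ‖x - v‖ + δ) * ‖x - v‖ := by
    have h1 := norm_sub_sub_fderiv_le_of_lipschitz hX hF' hL hx hv
    have h2 : ‖(F' v - J v) (x - v)‖ ≤ δ * ‖x - v‖ :=
      (ContinuousLinearMap.le_opNorm _ _).trans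
        (mul_le_mul_of_nonneg_right (hJ v hv) (norm_nonneg _))
    have h3 : F x - F v - J v (x - v) = (F x - F v - F' v (x - v)) + (F' v - J v) (x - v) := by
      rw [sub_apply]; abel
    rw [h3]
    refine (norm_add_le _ _).trans ?_
    linarith
  have hin := (real_inner_le_norm (F x - F v - J v (x - v)) (x - w)).trans
    (mul_le_mul_of_nonneg_right herr (norm_nonneg _))
  simp only [inner_add_left, inner_sub_left, real_inner_smul_left] at hsub hin ⊢
  nlinarith

/-- One-step decrease of the dual extrapolation potential. -/
lemma regularized_step_le (a b : E) {θ : ℝ} (h₁ : 1 / 32 ≤ θ) (h₂ : θ ≤ 1 / 22) :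
    θ * (‖a‖ ^ 2 + ‖a‖ * ‖b‖ - 10 * ⟪a, b⟫) - 1 / 2 * ‖a - b‖ ^ 2 ≤ -(21 / 100) * ‖a‖ ^ 2 := by
  rw [norm_sub_sq_real]
  have h := mul_le_mul_of_nonneg_left (real_inner_le_norm a b)
    (show 0 ≤ 1 - 10 * θ by linarith)
  have hθ : 0 ≤ 8 * θ - 81 / 2 * θ ^ 2 - 21 / 100 := by nlinarith
  nlinarith [sq_nonneg (‖b‖ - (1 - 9 * θ) * ‖a‖), mul_nonneg hθ (sq_nonneg ‖a‖)]

end Helpers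

/-- Theorem 3.3: convergence of VIJI in the nonmonotone case, η = 10, opt = 2:
for `k_T = argmin_{1 ≤ k ≤ T} ‖x_k − v_k‖`, the residue satisfies
`res(x_{k_T}) = sup_{x ∈ X} ⟪F(x_{k_T}), x_{k_T} − x⟫ ≤ 14 L D³ / T + 24 δ D² / √T`. -/
theorem viji_nonmonotone_convergence
    (d : ℕ) (X : Set (EuclideanSpace ℝ (Fin d)))
    (hXconv : Convex ℝ X) (hXclosed : IsClosed X) (hXbdd : Bornology.IsBounded X)
    (F : EuclideanSpace ℝ (Fin d) → EuclideanSpace ℝ (Fin d))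
    (F' : EuclideanSpace ℝ (Fin d) → EuclideanSpace ℝ (Fin d) →L[ℝ] EuclideanSpace ℝ (Fin d))
    (hF' : ∀ x, HasFDerivAt F (F' x) x)
    (L δ : ℝ)
    (hsmooth : ∀ x ∈ X, ∀ y ∈ X, ‖F' x - F' y‖ ≤ L * ‖x - y‖)
    (J : EuclideanSpace ℝ (Fin d) → EuclideanSpace ℝ (Fin d) →L[ℝ] EuclideanSpace ℝ (Fin d))
    (hJ : ∀ v ∈ X, ‖F' v - J v‖ ≤ δ)
    (Ω : EuclideanSpace ℝ (Fin d) → EuclideanSpace ℝ (Fin d) → EuclideanSpace ℝ (Fin d))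
    (hΩ : ∀ v x, Ω v x = F v + J v (x - v) + (10 * δ) • (x - v)
      + (5 * L * ‖x - v‖) • (x - v))
    (xs vs s : ℕ → EuclideanSpace ℝ (Fin d)) (lam : ℕ → ℝ)
    (hxsX : ∀ k, xs k ∈ X) (hvsX : ∀ k, vs k ∈ X)
    (hs0 : s 0 = 0)
    (hlampos : ∀ k, 0 < lam k)
    (hvmax : ∀ k, ∀ w ∈ X,
      ⟪s k, w - xs 0⟫ - 1 / 2 * ‖w - xs 0‖ ^ 2 ≤
        ⟪s k, vs (k + 1) - xs 0⟫ - 1 / 2 * ‖vs (k + 1) - xs 0‖ ^ 2)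
    (hsub : ∀ k, ∀ w ∈ X,
      ⟪Ω (vs (k + 1)) (xs (k + 1)), xs (k + 1) - w⟫ ≤
        L / 2 * ‖xs (k + 1) - vs (k + 1)‖ ^ 3 + δ * ‖xs (k + 1) - vs (k + 1)‖ ^ 2)
    (hlam : ∀ k, 1 / 32 ≤ lam (k + 1) * (L / 2 * ‖xs (k + 1) - vs (k + 1)‖ + δ) ∧
      lam (k + 1) * (L / 2 * ‖xs (k + 1) - vs (k + 1)‖ + δ) ≤ 1 / 22)
    (hsrec : ∀ k, s (k + 1) = s k - lam (k + 1) • F (xs (k + 1)))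
    (xstar : EuclideanSpace ℝ (Fin d)) (hxstarX : xstar ∈ X)
    (hminty : ∀ x ∈ X, 0 ≤ ⟪F x, x - xstar⟫)
    (D : ℝ) (hD : Metric.diam X = D) :
    ∀ T : ℕ, 1 ≤ T → ∀ kT ∈ Finset.Icc 1 T,
      (∀ k ∈ Finset.Icc 1 T, ‖xs kT - vs kT‖ ≤ ‖xs k - vs k‖) →
      sSup ((fun w => ⟪F (xs kT), xs kT - w⟫) '' X) ≤
        14 * L * D ^ 3 / (T : ℝ) + 24 * δ * D ^ 2 / Real.sqrt (T : ℝ) := by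
  have hdist : ∀ x ∈ X, ∀ y ∈ X, ‖x - y‖ ≤ D := fun x hx y hy => by
    rw [← hD, ← dist_eq_norm]; exact Metric.dist_le_diam_of_mem hXbdd hx hy
  have hD0 : 0 ≤ D := hD ▸ Metric.diam_nonneg
  have hδ : 0 ≤ δ := (norm_nonneg _).trans (hJ _ (hxsX 0))
  have hLD : 0 ≤ L ∨ D = 0 := by
    by_cases hX : X.Subsingleton
    · exact Or.inr (hD ▸ Metric.diam_subsingleton hX)
    · obtain ⟨x, hx, y, hy, hxy⟩ := Set.not_subsingleton_iff.1 hX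
      exact Or.inl (nonneg_of_mul_nonneg_left ((norm_nonneg _).trans (hsmooth x hx y hy))
        (norm_pos_iff.2 (sub_ne_zero.2 hxy)))
  have hm (k : ℕ) : 0 < L / 2 * ‖xs (k + 1) - vs (k + 1)‖ + δ :=
    pos_of_mul_pos_right (by linarith [(hlam k).1]) (hlampos (k + 1)).le
  have hmodel (k : ℕ) (w : EuclideanSpace ℝ (Fin d)) (hw : w ∈ X) :=
    inner_le_of_inexact_model hXconv hF' hsmooth hJ (hxsX (k + 1)) (hvsX (k + 1))
      (w := w) (by rw [← hΩ]; exact hsub k w hw)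
  -- The dual extrapolation potential decreases.
  have hpot (T : ℕ) : ⟪s T, vs (T + 1) - xs 0⟫ - 1 / 2 * ‖vs (T + 1) - xs 0‖ ^ 2
      + ∑ k ∈ Finset.range T, lam (k + 1) * ⟪F (xs (k + 1)), xs (k + 1) - xs 0⟫
      + 21 / 100 * ∑ k ∈ Finset.range T, ‖xs (k + 1) - vs (k + 1)‖ ^ 2 ≤ 0 := by
    induction T with
    | zero =>
      simp only [hs0, inner_zero_left, Finset.range_zero, Finset.sum_empty]
      nlinarith [sq_nonneg ‖vs (0 + 1) - xs 0‖]
    | succ T ih =>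
      have hgap := inner_sub_half_norm_sq_add_le_of_isMax hXconv (hvsX (T + 1)) (hvmax T)
        (hvsX (T + 1 + 1))
      have hstep := regularized_step_le (xs (T + 1) - vs (T + 1)) (xs (T + 1) - vs (T + 1 + 1))
        (hlam T).1 (hlam T).2
      rw [sub_sub_sub_cancel_left] at hstep
      have hF := mul_le_mul_of_nonneg_left (hmodel T _ (hvsX (T + 1 + 1))) (hlampos (T + 1)).le
      rw [← mul_assoc] at hF
      have hsplit : ⟪F (xs (T + 1)), xs (T + 1) - vs (T + 1 + 1)⟫ =
          ⟪F (xs (T + 1)), xs (T + 1) - xs 0⟫ - ⟪F (xs (T + 1)), vs (T + 1 + 1) - xs 0⟫ := by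
        rw [← inner_sub_right, sub_sub_sub_cancel_right]
      rw [hsplit, mul_sub] at hF
      rw [Finset.sum_range_succ, Finset.sum_range_succ, hsrec, inner_sub_left,
        real_inner_smul_left]
      linarith
  have hsumF (T : ℕ) : ∑ k ∈ Finset.range T, lam (k + 1) * ⟪F (xs (k + 1)), xs (k + 1) - xs 0⟫
      + ⟪s T, xstar - xs 0⟫ =
        ∑ k ∈ Finset.range T, lam (k + 1) * ⟪F (xs (k + 1)), xs (k + 1) - xstar⟫ := by
    induction T with
    | zero => simp [hs0]
    | succ T ih =>
      rw [Finset.sum_range_succ, Finset.sum_range_succ, ← ih, hsrec, inner_sub_left,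
        real_inner_smul_left]
      simp only [inner_sub_right (F (xs (T + 1)))]
      ring
  have hsumsq (T : ℕ) :
      21 / 100 * ∑ k ∈ Finset.range T, ‖xs (k + 1) - vs (k + 1)‖ ^ 2 ≤ 1 / 2 * D ^ 2 := by
    have hnonneg :
        0 ≤ ∑ k ∈ Finset.range T, lam (k + 1) * ⟪F (xs (k + 1)), xs (k + 1) - xstar⟫ :=
      Finset.sum_nonneg fun k _ => mul_nonneg (hlampos _).le (hminty _ (hxsX _))
    have hsq : ‖xstar - xs 0‖ ^ 2 ≤ D ^ 2 := by gcongr; exact hdist _ hxstarX _ (hxsX 0)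
    linarith [hpot T, hsumF T, hvmax T xstar hxstarX]
  intro T hT kT hkT hmin
  obtain ⟨k, rfl⟩ : ∃ k, kT = k + 1 := ⟨kT - 1, by have := Finset.mem_Icc.1 hkT; omega⟩
  have hTpos : (0 : ℝ) < T := by exact_mod_cast hT
  have hr : T * ‖xs (k + 1) - vs (k + 1)‖ ^ 2 ≤ 12 / 5 * D ^ 2 := by
    have h : ∑ _j ∈ Finset.range T, ‖xs (k + 1) - vs (k + 1)‖ ^ 2 ≤
        ∑ j ∈ Finset.range T, ‖xs (j + 1) - vs (j + 1)‖ ^ 2 :=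
      Finset.sum_le_sum fun j hj => by
        gcongr
        exact hmin _ (Finset.mem_Icc.2 ⟨by omega, by have := Finset.mem_range.1 hj; omega⟩)
    rw [Finset.sum_const, Finset.card_range, nsmul_eq_mul] at h
    nlinarith [hsumsq T, sq_nonneg D]
  refine csSup_le (Set.Nonempty.image _ ⟨_, hxstarX⟩) ?_
  rintro _ ⟨w, hw, rfl⟩
  have hres : ⟪F (xs (k + 1)), xs (k + 1) - w⟫ ≤
      (L / 2 * ‖xs (k + 1) - vs (k + 1)‖ + δ) * (11 * ‖xs (k + 1) - vs (k + 1)‖ * D) := by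
    refine (hmodel k w hw).trans (mul_le_mul_of_nonneg_left ?_ (hm k).le)
    have h1 : ⟪xs (k + 1) - vs (k + 1), xs (k + 1) - w⟫ = ‖xs (k + 1) - vs (k + 1)‖ ^ 2 -
        ⟪xs (k + 1) - vs (k + 1), w - vs (k + 1)⟫ := by
      rw [← real_inner_self_eq_norm_sq, ← inner_sub_right, sub_sub_sub_cancel_right]
    have h2 := (real_inner_le_norm (xs (k + 1) - vs (k + 1)) (w - vs (k + 1))).trans
      (mul_le_mul_of_nonneg_left (hdist w hw _ (hvsX (k + 1))) (norm_nonneg _))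
    have h3 := mul_le_mul_of_nonneg_left (hdist _ (hxsX (k + 1)) w hw)
      (norm_nonneg (xs (k + 1) - vs (k + 1)))
    nlinarith [sq_nonneg ‖xs (k + 1) - vs (k + 1)‖]
  refine hres.trans ?_
  have hr0 : 0 ≤ ‖xs (k + 1) - vs (k + 1)‖ := norm_nonneg _
  generalize ‖xs (k + 1) - vs (k + 1)‖ = r at hr hr0
  have hsqrt : 0 < √(T : ℝ) := Real.sqrt_pos.2 hTpos
  have hquad : 11 / 2 * L * r ^ 2 * D ≤ 14 * L * D ^ 3 / T := by
    rw [le_div_iff₀ hTpos]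
    rcases hLD with hL | rfl
    · have := mul_le_mul_of_nonneg_left hr (mul_nonneg hL hD0)
      have : 0 ≤ L * D ^ 3 := by positivity
      linarith
    · simp
  have hlin : 11 * δ * r * D ≤ 24 * δ * D ^ 2 / √(T : ℝ) := by
    have hrT : r * √(T : ℝ) ≤ 2 * D := by
      refine le_of_sq_le_sq ?_ (by positivity)
      rw [mul_pow, Real.sq_sqrt hTpos.le]
      nlinarith [sq_nonneg D]
    rw [le_div_iff₀ hsqrt]
    have := mul_le_mul_of_nonneg_left hrT (mul_nonneg hδ hD0)
    have : 0 ≤ δ * D ^ 2 := by positivity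
    linarith
  linarith
end

section
/- Let f, F, J, δ, L and the VIJI-MinMax iterates (z_k, v_k, s_k, λ_k) with η = 5 and tolerance τ ∈ (0,1) be as in the context, with global saddle point z* = (x*, y*). Set β = 5∥z_0 − z*∥ and z̃_T = (∑_{k=1}^T λ_k z_k)/(∑_{k=1}^T λ_k). Then for every integer T ≥ 1, the restricted primal-dual gap satisfies gap(z̃_T, β) ≤ 1152√2 · L ∥z_0 − z*∥³ / T^{3/2} + 576√2 · δ ∥z_0 − z*∥² / T. -/
open scoped RealInnerProductSpace

/-- The product space `ℝ^m × ℝ^n` with the Euclidean (`L²`) norm. -/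
abbrev Wp (m n : ℕ) := WithLp 2 (EuclideanSpace ℝ (Fin m) × EuclideanSpace ℝ (Fin n))

/-- Pairing `(a, b) ↦ z = (a, b) ∈ ℝ^{m+n}`. -/
noncomputable def pmk {m n : ℕ} (a : EuclideanSpace ℝ (Fin m)) (b : EuclideanSpace ℝ (Fin n)) : Wp m n :=
  (WithLp.equiv 2 _).symm (a, b)

/-- First (`x`-) component of `z ∈ ℝ^{m+n}`. -/
noncomputable def pfst {m n : ℕ} (z : Wp m n) : EuclideanSpace ℝ (Fin m) := ((WithLp.equiv 2 _) z).1

/-- Second (`y`-) component of `z ∈ ℝ^{m+n}`. -/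
noncomputable def psnd {m n : ℕ} (z : Wp m n) : EuclideanSpace ℝ (Fin n) := ((WithLp.equiv 2 _) z).2

/-- First-order characterisation of convexity. -/
theorem ConvexOn.inner_gradient_le_sub {E : Type*} [NormedAddCommGroup E] [InnerProductSpace ℝ E]
    [CompleteSpace E] {g : E → ℝ} (hg : ConvexOn ℝ Set.univ g) {x : E}
    (hd : DifferentiableAt ℝ g x) (y : E) : ⟪gradient g x, y - x⟫ ≤ g y - g x := by
  have h1 : ConvexOn ℝ Set.univ (g ∘ AffineMap.lineMap (k := ℝ) x y) := by
    simpa using hg.comp_affineMap (AffineMap.lineMap (k := ℝ) x y)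
  have h2 : HasDerivAt (g ∘ AffineMap.lineMap (k := ℝ) x y) ⟪gradient g x, y - x⟫ 0 := by
    have h3 : HasFDerivAt g (InnerProductSpace.toDual ℝ E (gradient g x))
        (AffineMap.lineMap (k := ℝ) x y 0) := by
      simpa using hd.hasGradientAt.hasFDerivAt
    have h4 := h3.comp_hasDerivAt (0 : ℝ) (AffineMap.hasDerivAt_lineMap (a := x) (b := y))
    simpa using h4
  have h5 := h1.le_slope_of_hasDerivAt (Set.mem_univ _) (Set.mem_univ _) zero_lt_one h2
  simpa [slope_def_field] using h5

/-- A map whose derivative is `L`-Lipschitz has a quadratic first-order Taylor remainder. -/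
theorem norm_sub_sub_fderiv_le_of_lipschitz_s18 {E G : Type*} [NormedAddCommGroup E] [NormedSpace ℝ E]
    [NormedAddCommGroup G] [NormedSpace ℝ G] {F : E → G} {F' : E → E →L[ℝ] G} {L : ℝ}
    (hF' : ∀ z, HasFDerivAt F (F' z) z) (hL : ∀ z w, ‖F' z - F' w‖ ≤ L * ‖z - w‖) (v z : E) :
    ‖F z - F v - F' v (z - v)‖ ≤ L / 2 * ‖z - v‖ ^ 2 := by
  have hline : ∀ t : ℝ, HasDerivAt (fun t : ℝ => v + t • (z - v)) (z - v) t := fun t => by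
    simpa using ((hasDerivAt_id t).smul_const (z - v)).const_add v
  have hg : ∀ t : ℝ, HasDerivAt
      (fun t : ℝ => F (v + t • (z - v)) - F v - t • F' v (z - v))
      (F' (v + t • (z - v)) (z - v) - F' v (z - v)) t := fun t => by
    have h := (((hF' (v + t • (z - v))).comp_hasDerivAt t (hline t)).sub_const (F v)).sub
      ((hasDerivAt_id t).smul_const (F' v (z - v)))
    rwa [one_smul] at h
  have hB : ∀ t : ℝ, HasDerivAt (fun t : ℝ => L / 2 * ‖z - v‖ ^ 2 * t ^ 2)
      (L * ‖z - v‖ ^ 2 * t) t := fun t =>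
    ((hasDerivAt_pow 2 t).const_mul (L / 2 * ‖z - v‖ ^ 2)).congr_deriv (by push_cast; ring)
  have key := image_norm_le_of_norm_deriv_right_le_deriv_boundary (a := 0) (b := 1)
    (fun t _ => (hg t).continuousAt.continuousWithinAt) (fun t _ => (hg t).hasDerivWithinAt)
    (B := fun t => L / 2 * ‖z - v‖ ^ 2 * t ^ 2) (by simp) hB (fun t ht => by
      rw [← sub_apply]
      refine (ContinuousLinearMap.le_opNorm _ _).trans ?_
      refine (mul_le_mul_of_nonneg_right (hL _ _) (norm_nonneg _)).trans (le_of_eq ?_)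
      rw [add_sub_cancel_left, norm_smul, Real.norm_of_nonneg ht.1]
      ring) (Set.right_mem_Icc.2 zero_le_one)
  simpa using key

/-- If `F` represents the functionals `A` up to a norm-preserving change of the test vector, then
increments of the derivative of `F` are no larger than those of the derivative of `A`. -/
theorem norm_fderiv_sub_le_of_inner_eq {E : Type*} [NormedAddCommGroup E] [InnerProductSpace ℝ E]
    {F : E → E} {F' : E → E →L[ℝ] E} {A : E → E →L[ℝ] ℝ} {A' : E → E →L[ℝ] E →L[ℝ] ℝ}
    {σ : E → E} (hσ : ∀ h, ‖σ h‖ = ‖h‖) (hFA : ∀ z h, ⟪F z, h⟫ = A z (σ h))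
    (hA : ∀ z, HasFDerivAt A (A' z) z) (hF : ∀ z, HasFDerivAt F (F' z) z) {z w : E} {C : ℝ}
    (hC : ‖A' z - A' w‖ ≤ C) : ‖F' z - F' w‖ ≤ C := by
  have hinner : ∀ z k h : E, ⟪F' z k, h⟫ = A' z k (σ h) := fun z k h => by
    have h1 := (hF z).inner ℝ (hasFDerivAt_const h z)
    have h2 := (hA z).clm_apply (hasFDerivAt_const (σ h) z)
    have h3 : (fun z => ⟪F z, h⟫) = fun z => A z (σ h) := funext fun z => hFA z h
    rw [h3] at h1
    simpa using congrArg (fun l => l k) (h1.unique h2)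
  have hnn : 0 ≤ C := (norm_nonneg (A' z - A' w)).trans hC
  refine ContinuousLinearMap.opNorm_le_bound _ hnn fun k => ?_
  set g := (F' z - F' w) k with hg
  have h1 : ‖g‖ * ‖g‖ ≤ C * ‖k‖ * ‖g‖ := by
    have h2 : ‖g‖ * ‖g‖ = (A' z - A' w) k (σ g) := by
      rw [← real_inner_self_eq_norm_mul_norm]
      nth_rewrite 1 [hg]
      rw [sub_apply, inner_sub_left, hinner, hinner, sub_apply, sub_apply]
    rw [h2]
    refine (Real.le_norm_self _).trans ((ContinuousLinearMap.le_opNorm₂ _ _ _).trans ?_)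
    rw [hσ]
    gcongr
  rcases (norm_nonneg g).eq_or_lt with h | h
  · rw [← h]
    positivity
  · exact le_of_mul_le_mul_right h1 h

section RegretBound

variable {E : Type*} [NormedAddCommGroup E] [InnerProductSpace ℝ E]

/-- Three-point identity for one dual extrapolation step from `w` to `w - b` through `z`. -/
theorem inner_dual_extrapolation (w z u b : E) :
    ⟪b, z - u⟫ = (‖w - u‖ ^ 2 - ‖w - b - u‖ ^ 2) / 2 + (‖b + (z - w)‖ ^ 2 - ‖z - w‖ ^ 2) / 2 := by
  have h1 : z - u = (w - u) + (z - w) := by abel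
  have h2 : w - b - u = (w - u) - b := by abel
  rw [h2, norm_sub_sq_real (w - u) b, norm_add_sq_real, h1, inner_add_right,
    real_inner_comm (w - u) b]
  ring

/-- The step `λ F(z)` nearly cancels `z - v` when `z` approximately solves the inexact model. -/
theorem norm_smul_add_le_of_model {Fz Fv Jd d : E} {L δ lam : ℝ} (hL : 0 ≤ L)
    (hlam : 0 < lam) (h1 : 1 / 16 ≤ lam * (L * ‖d‖ + δ)) (h2 : lam * (L * ‖d‖ + δ) ≤ 1 / 12)
    (herr : ‖Fz - Fv - Jd‖ ≤ L / 2 * ‖d‖ ^ 2 + δ * ‖d‖)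
    (hmodel : ‖Fv + Jd + (5 * δ) • d + (5 * L * ‖d‖) • d‖ ≤ L / 2 * ‖d‖ ^ 2 + δ * ‖d‖) :
    ‖lam • Fz + d‖ ≤ 13 / 16 * ‖d‖ := by
  have hdec : lam • Fz + d = lam • (Fz - Fv - Jd)
      + lam • (Fv + Jd + (5 * δ) • d + (5 * L * ‖d‖) • d)
      + (1 - 5 * (lam * (L * ‖d‖ + δ))) • d := by module
  have hd := norm_nonneg d
  rw [hdec]
  refine norm_add₃_le.trans ?_
  rw [norm_smul, norm_smul, norm_smul, Real.norm_of_nonneg hlam.le,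
    Real.norm_of_nonneg (by linarith : (0 : ℝ) ≤ 1 - 5 * (lam * (L * ‖d‖ + δ)))]
  have h3 := mul_le_mul_of_nonneg_left herr hlam.le
  have h4 := mul_le_mul_of_nonneg_left hmodel hlam.le
  have h5 : 0 ≤ lam * (L * ‖d‖ ^ 2) := by positivity
  have h6 := mul_le_mul_of_nonneg_right h1 hd
  linarith

/-- Regret bound for dual extrapolation with contracting steps. -/
theorem sum_mul_inner_add_le_of_contracting {G zs vs s : ℕ → E} {lam : ℕ → ℝ} (hs0 : s 0 = 0)
    (hvrec : ∀ k, vs (k + 1) = zs 0 + s k)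
    (hsrec : ∀ k, s (k + 1) = s k - lam (k + 1) • G (k + 1))
    (hstep : ∀ k, ‖lam (k + 1) • G (k + 1) + (zs (k + 1) - vs (k + 1))‖
      ≤ 13 / 16 * ‖zs (k + 1) - vs (k + 1)‖) (u : E) (T : ℕ) :
    ∑ k ∈ Finset.Icc 1 T, lam k * ⟪G k, zs k - u⟫
      + 1 / 8 * ∑ k ∈ Finset.Icc 1 T, ‖zs k - vs k‖ ^ 2
      ≤ ‖zs 0 - u‖ ^ 2 / 2 - ‖zs 0 + s T - u‖ ^ 2 / 2 := by
  induction T with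
  | zero => simp [hs0]
  | succ T ih =>
    rw [Finset.sum_Icc_succ_top (by lia), Finset.sum_Icc_succ_top (by lia)]
    have h1 := inner_dual_extrapolation (vs (T + 1)) (zs (T + 1)) u (lam (T + 1) • G (T + 1))
    have h2 : vs (T + 1) - lam (T + 1) • G (T + 1) - u = zs 0 + s (T + 1) - u := by
      rw [hvrec, hsrec]; abel
    rw [h2, real_inner_smul_left, hvrec T, ← hvrec T] at h1
    have h3 := pow_le_pow_left₀ (norm_nonneg _) (hstep T) 2
    have h4 := sq_nonneg ‖zs (T + 1) - vs (T + 1)‖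
    rw [← hvrec T] at ih
    rw [mul_pow] at h3
    linarith

end RegretBound

/-- Lower bound on the total step size of the VIJI scheme. -/
theorem sq_le_sum_step_mul {T : ℕ} {lam r : ℕ → ℝ} {L δ D : ℝ} (hL : 0 ≤ L)
    (hD : 0 ≤ D) (hlam : ∀ k ∈ Finset.Icc 1 T, 0 < lam k)
    (hstep : ∀ k ∈ Finset.Icc 1 T, 1 / 16 ≤ lam k * (L * r k + δ))
    (hr : ∑ k ∈ Finset.Icc 1 T, r k ^ 2 ≤ 4 * D ^ 2) :
    (T : ℝ) ^ 2 ≤ 16 * (∑ k ∈ Finset.Icc 1 T, lam k) * (2 * L * D * √T + δ * T) := by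
  have hpos : ∀ k ∈ Finset.Icc 1 T, 0 < L * r k + δ := fun k hk =>
    pos_of_mul_pos_right ((by norm_num : (0 : ℝ) < 1 / 16).trans_le (hstep k hk)) (hlam k hk).le
  have hCS := Finset.sum_sq_le_sum_mul_sum_of_sq_le_mul (Finset.Icc 1 T) (r := fun _ => (1 : ℝ))
    (f := fun k => 16 * lam k) (g := fun k => L * r k + δ)
    (fun k hk => by have := hlam k hk; positivity) (fun k hk => (hpos k hk).le)
    (fun k hk => by have := hstep k hk; linarith)
  have hsum : ∑ k ∈ Finset.Icc 1 T, r k ≤ 2 * D * √T := by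
    have h1 := sq_sum_le_card_mul_sum_sq (s := Finset.Icc 1 T) (f := r)
    rw [Nat.card_Icc, Nat.add_sub_cancel] at h1
    refine (abs_le_of_sq_le_sq' ?_ (by positivity)).2
    rw [mul_pow, Real.sq_sqrt (Nat.cast_nonneg T)]
    nlinarith [mul_le_mul_of_nonneg_left hr (Nat.cast_nonneg (α := ℝ) T)]
  rw [← Finset.mul_sum, Finset.sum_add_distrib, ← Finset.mul_sum] at hCS
  simp only [Finset.sum_const, Nat.card_Icc, Nat.add_sub_cancel, nsmul_eq_mul, mul_one] at hCS
  refine hCS.trans (mul_le_mul_of_nonneg_left ?_ ?_)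
  · nlinarith [mul_le_mul_of_nonneg_left hsum hL]
  · have := Finset.sum_nonneg fun k hk => (hlam k hk).le
    positivity

section Product

variable {m n : ℕ}

theorem pmk_pfst_psnd (z : Wp m n) : pmk (pfst z) (psnd z) = z := rfl

theorem inner_pmk (a : EuclideanSpace ℝ (Fin m)) (b : EuclideanSpace ℝ (Fin n)) (z : Wp m n) :
    ⟪pmk a b, z⟫ = ⟪a, pfst z⟫ + ⟪b, psnd z⟫ := rfl

theorem norm_sq_eq_pfst_psnd (z : Wp m n) : ‖z‖ ^ 2 = ‖pfst z‖ ^ 2 + ‖psnd z‖ ^ 2 :=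
  WithLp.prod_norm_sq_eq_of_L2 z

theorem pfst_sum_smul {ι : Type*} (t : Finset ι) (c : ι → ℝ) (z : ι → Wp m n) :
    pfst (∑ i ∈ t, c i • z i) = ∑ i ∈ t, c i • pfst (z i) :=
  (map_sum (WithLp.fstL 2 ℝ (EuclideanSpace ℝ (Fin m)) (EuclideanSpace ℝ (Fin n))) _ t).trans
    (Finset.sum_congr rfl fun _ _ => rfl)

theorem psnd_sum_smul {ι : Type*} (t : Finset ι) (c : ι → ℝ) (z : ι → Wp m n) :
    psnd (∑ i ∈ t, c i • z i) = ∑ i ∈ t, c i • psnd (z i) :=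
  (map_sum (WithLp.sndL 2 ℝ (EuclideanSpace ℝ (Fin m)) (EuclideanSpace ℝ (Fin n))) _ t).trans
    (Finset.sum_congr rfl fun _ _ => rfl)

theorem hasFDerivAt_pmk_left (a : EuclideanSpace ℝ (Fin m)) (b : EuclideanSpace ℝ (Fin n)) :
    HasFDerivAt (fun a' => pmk a' b)
      (((WithLp.prodContinuousLinearEquiv 2 ℝ (EuclideanSpace ℝ (Fin m))
        (EuclideanSpace ℝ (Fin n))).symm.toContinuousLinearMap).comp
        (ContinuousLinearMap.inl ℝ _ _)) a :=
  ((WithLp.prodContinuousLinearEquiv 2 ℝ (EuclideanSpace ℝ (Fin m))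
    (EuclideanSpace ℝ (Fin n))).symm.toContinuousLinearMap).hasFDerivAt.comp a
    (hasFDerivAt_prodMk_left a b)

theorem hasFDerivAt_pmk_right (a : EuclideanSpace ℝ (Fin m)) (b : EuclideanSpace ℝ (Fin n)) :
    HasFDerivAt (fun b' => pmk a b')
      (((WithLp.prodContinuousLinearEquiv 2 ℝ (EuclideanSpace ℝ (Fin m))
        (EuclideanSpace ℝ (Fin n))).symm.toContinuousLinearMap).comp
        (ContinuousLinearMap.inr ℝ _ _)) b :=
  ((WithLp.prodContinuousLinearEquiv 2 ℝ (EuclideanSpace ℝ (Fin m))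
    (EuclideanSpace ℝ (Fin n))).symm.toContinuousLinearMap).hasFDerivAt.comp b
    (hasFDerivAt_prodMk_right a b)

theorem inner_gradient_pmk_left {f : Wp m n → ℝ} (hf : Differentiable ℝ f)
    (a h : EuclideanSpace ℝ (Fin m)) (b : EuclideanSpace ℝ (Fin n)) :
    ⟪gradient (fun a' => f (pmk a' b)) a, h⟫ = fderiv ℝ f (pmk a b) (pmk h 0) := by
  have h1 := (hf (pmk a b)).hasFDerivAt.comp a (hasFDerivAt_pmk_left a b)
  have h2 : fderiv ℝ (fun a' => f (pmk a' b)) a = _ := h1.fderiv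
  rw [gradient, InnerProductSpace.toDual_symm_apply, h2]
  rfl

theorem inner_gradient_pmk_right {f : Wp m n → ℝ} (hf : Differentiable ℝ f)
    (a : EuclideanSpace ℝ (Fin m)) (b h : EuclideanSpace ℝ (Fin n)) :
    ⟪gradient (fun b' => f (pmk a b')) b, h⟫ = fderiv ℝ f (pmk a b) (pmk 0 h) := by
  have h1 := (hf (pmk a b)).hasFDerivAt.comp b (hasFDerivAt_pmk_right a b)
  have h2 : fderiv ℝ (fun b' => f (pmk a b')) b = _ := h1.fderiv
  rw [gradient, InnerProductSpace.toDual_symm_apply, h2]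
  rfl

theorem differentiable_pmk_left {f : Wp m n → ℝ} (hf : Differentiable ℝ f)
    (b : EuclideanSpace ℝ (Fin n)) : Differentiable ℝ fun a => f (pmk a b) :=
  fun a => ((hf (pmk a b)).hasFDerivAt.comp a (hasFDerivAt_pmk_left a b)).differentiableAt

theorem differentiable_pmk_right {f : Wp m n → ℝ} (hf : Differentiable ℝ f)
    (a : EuclideanSpace ℝ (Fin m)) : Differentiable ℝ fun b => f (pmk a b) :=
  fun b => ((hf (pmk a b)).hasFDerivAt.comp b (hasFDerivAt_pmk_right a b)).differentiableAt

theorem norm_pmk_neg (z : Wp m n) : ‖pmk (pfst z) (-psnd z)‖ = ‖z‖ := by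
  rw [← sq_eq_sq₀ (norm_nonneg _) (norm_nonneg _), norm_sq_eq_pfst_psnd, norm_sq_eq_pfst_psnd z]
  exact congrArg (‖pfst z‖ ^ 2 + · ^ 2) (norm_neg (psnd z))

variable {f : Wp m n → ℝ} {F : Wp m n → Wp m n}

theorem inner_saddleOperator (hf : Differentiable ℝ f)
    (hFdef : ∀ a b, F (pmk a b) =
      pmk (gradient (fun a' => f (pmk a' b)) a) (-(gradient (fun b' => f (pmk a b')) b)))
    (z h : Wp m n) : ⟪F z, h⟫ = fderiv ℝ f z (pmk (pfst h) (-psnd h)) := by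
  rw [← pmk_pfst_psnd z, hFdef, inner_pmk, inner_neg_left, ← inner_neg_right,
    inner_gradient_pmk_left hf, inner_gradient_pmk_right hf, ← map_add]
  congr 1
  exact congrArg₂ pmk (add_zero (pfst h)) (zero_add (-psnd h))

theorem sub_le_inner_saddleOperator (hf : Differentiable ℝ f)
    (hconv : ∀ b, ConvexOn ℝ Set.univ (fun a => f (pmk a b)))
    (hconc : ∀ a, ConcaveOn ℝ Set.univ (fun b => f (pmk a b)))
    (hFdef : ∀ a b, F (pmk a b) =
      pmk (gradient (fun a' => f (pmk a' b)) a) (-(gradient (fun b' => f (pmk a b')) b)))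
    (z : Wp m n) (a : EuclideanSpace ℝ (Fin m)) (b : EuclideanSpace ℝ (Fin n)) :
    f (pmk (pfst z) b) - f (pmk a (psnd z)) ≤ ⟪F z, z - pmk a b⟫ := by
  have h1 := (hconv (psnd z)).inner_gradient_le_sub (differentiable_pmk_left hf _ (pfst z)) a
  have h2 := (hconc (pfst z)).neg.inner_gradient_le_sub
    (differentiable_pmk_right hf _ (psnd z)).neg b
  have h3 : gradient (-fun b' => f (pmk (pfst z) b')) (psnd z)
      = -gradient (fun b' => f (pmk (pfst z) b')) (psnd z) := by
    rw [gradient, fderiv_neg, map_neg, gradient]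
  have h4 : F z = _ := hFdef (pfst z) (psnd z)
  have h5 : ⟪F z, z - pmk a b⟫ = ⟪gradient (fun a' => f (pmk a' (psnd z))) (pfst z), pfst z - a⟫
      + ⟪-gradient (fun b' => f (pmk (pfst z) b')) (psnd z), psnd z - b⟫ := by
    rw [h4]; rfl
  rw [h3] at h2
  rw [h5, ← neg_sub a, ← neg_sub b, inner_neg_right, inner_neg_right]
  simp only [Pi.neg_apply] at h2
  linarith

theorem norm_sub_le_of_hessian_lipschitz (hf : ContDiff ℝ 2 f)
    (hFdef : ∀ a b, F (pmk a b) =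
      pmk (gradient (fun a' => f (pmk a' b)) a) (-(gradient (fun b' => f (pmk a b')) b)))
    {L : ℝ} (hhess : ∀ z w : Wp m n,
      ‖fderiv ℝ (fderiv ℝ f) z - fderiv ℝ (fderiv ℝ f) w‖ ≤ L * ‖z - w‖)
    {F' : Wp m n → Wp m n →L[ℝ] Wp m n} (hF' : ∀ z, HasFDerivAt F (F' z) z) (z w : Wp m n) :
    ‖F' z - F' w‖ ≤ L * ‖z - w‖ := by
  have hd : Differentiable ℝ f := hf.differentiable (by norm_num)
  have hd2 : Differentiable ℝ (fderiv ℝ f) :=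
    (hf.fderiv_right (m := 1) (by norm_num)).differentiable (by norm_num)
  exact norm_fderiv_sub_le_of_inner_eq (σ := fun h => pmk (pfst h) (-psnd h)) norm_pmk_neg
    (inner_saddleOperator hd hFdef) (fun z => (hd2 z).hasFDerivAt) hF' (hhess z w)

/-- Jensen's inequality for the primal-dual gap of a weighted average. -/
theorem sub_weighted_average_le
    (hconv : ∀ b, ConvexOn ℝ Set.univ (fun a => f (pmk a b)))
    (hconc : ∀ a, ConcaveOn ℝ Set.univ (fun b => f (pmk a b)))
    {ι : Type*} {t : Finset ι} {lam : ι → ℝ} (hlam : ∀ k ∈ t, 0 ≤ lam k)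
    (hpos : 0 < ∑ k ∈ t, lam k) (z : ι → Wp m n)
    (a : EuclideanSpace ℝ (Fin m)) (b : EuclideanSpace ℝ (Fin n)) :
    f (pmk (pfst ((∑ k ∈ t, lam k)⁻¹ • ∑ k ∈ t, lam k • z k)) b)
      - f (pmk a (psnd ((∑ k ∈ t, lam k)⁻¹ • ∑ k ∈ t, lam k • z k)))
      ≤ (∑ k ∈ t, lam k)⁻¹
        * ∑ k ∈ t, lam k * (f (pmk (pfst (z k)) b) - f (pmk a (psnd (z k)))) := by
  have hw0 : ∀ k ∈ t, 0 ≤ (∑ k ∈ t, lam k)⁻¹ * lam k := fun k hk =>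
    mul_nonneg (inv_nonneg.2 hpos.le) (hlam k hk)
  have hw1 : ∑ k ∈ t, (∑ k ∈ t, lam k)⁻¹ * lam k = 1 := by
    rw [← Finset.mul_sum, inv_mul_cancel₀ hpos.ne']
  have h1 := (hconv b).map_sum_le hw0 hw1 (p := fun k => pfst (z k)) fun _ _ => Set.mem_univ _
  have h2 := (hconc a).le_map_sum hw0 hw1 (p := fun k => psnd (z k)) fun _ _ => Set.mem_univ _
  rw [← pfst_sum_smul] at h1
  rw [← psnd_sum_smul] at h2
  simp only [smul_eq_mul, mul_smul, mul_assoc] at h1 h2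
  rw [← Finset.smul_sum, ← Finset.mul_sum] at h1 h2
  simp only [mul_sub, Finset.sum_sub_distrib]
  linarith

end Product

/-- Bounding the restricted gap by a bound over all pairs of comparison points. -/
theorem csSup_sub_csInf_le {A B : Set ℝ} (hA : A.Nonempty) (hB : B.Nonempty) {R : ℝ}
    (h : ∀ x ∈ A, ∀ y ∈ B, x - y ≤ R) : sSup A - sInf B ≤ R := by
  have : sSup A ≤ R + sInf B := csSup_le hA fun x hx => by
    have : x - R ≤ sInf B := le_csInf hB fun y hy => by linarith [h x hx y hy]
    linarith
  linarith

/-- Theorem on VIJI-MinMax convergence, η = 5: for the weighted average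
`z̃_T = (∑ λ_k z_k)/(∑ λ_k)` and `β = 5‖z_0 − z*‖`, the restricted primal-dual gap
`gap(z̃_T, β) = max_{‖y − y*‖ ≤ β} f(x̃_T, y) − min_{‖x − x*‖ ≤ β} f(x, ỹ_T)` satisfies
`gap(z̃_T, β) ≤ 1152√2 L ‖z_0 − z*‖³ / T^{3/2} + 576√2 δ ‖z_0 − z*‖² / T`. -/
theorem viji_minmax_convergence
    (m n : ℕ)
    (f : Wp m n → ℝ) (hf : ContDiff ℝ 2 f)
    (hconv : ∀ b, ConvexOn ℝ Set.univ (fun a => f (pmk a b)))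
    (hconc : ∀ a, ConcaveOn ℝ Set.univ (fun b => f (pmk a b)))
    (L : ℝ)
    (hhess : ∀ z w : Wp m n,
      ‖fderiv ℝ (fderiv ℝ f) z - fderiv ℝ (fderiv ℝ f) w‖ ≤ L * ‖z - w‖)
    (F : Wp m n → Wp m n)
    (hFdef : ∀ a b, F (pmk a b) =
      pmk (gradient (fun a' => f (pmk a' b)) a) (-(gradient (fun b' => f (pmk a b')) b)))
    (F' : Wp m n → Wp m n →L[ℝ] Wp m n) (hF' : ∀ z, HasFDerivAt F (F' z) z)
    (δ : ℝ) (J : Wp m n → Wp m n →L[ℝ] Wp m n)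
    (hJ : ∀ v, ‖F' v - J v‖ ≤ δ)
    (Ω : Wp m n → Wp m n → Wp m n)
    (hΩ : ∀ v z, Ω v z = F v + J v (z - v) + (5 * δ) • (z - v)
      + (5 * L * ‖z - v‖) • (z - v))
    (xstar : EuclideanSpace ℝ (Fin m)) (ystar : EuclideanSpace ℝ (Fin n))
    (hsaddle : ∀ a b, f (pmk xstar b) ≤ f (pmk xstar ystar) ∧
      f (pmk xstar ystar) ≤ f (pmk a ystar))
    (zs vs s : ℕ → Wp m n) (lam : ℕ → ℝ)
    (τ : ℝ) (hτ0 : 0 < τ) (hτ1 : τ < 1)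
    (hs0 : s 0 = 0)
    (hlampos : ∀ k, 0 < lam k)
    (hvrec : ∀ k, vs (k + 1) = zs 0 + s k)
    (hsub : ∀ k, ‖Ω (vs (k + 1)) (zs (k + 1))‖ ≤
      τ * min (L / 2 * ‖zs (k + 1) - vs (k + 1)‖ ^ 2 + δ * ‖zs (k + 1) - vs (k + 1)‖)
        ‖F (vs (k + 1))‖)
    (hlam : ∀ k, 1 / 16 ≤ lam (k + 1) * (L * ‖zs (k + 1) - vs (k + 1)‖ + δ) ∧
      lam (k + 1) * (L * ‖zs (k + 1) - vs (k + 1)‖ + δ) ≤ 1 / 12)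
    (hsrec : ∀ k, s (k + 1) = s k - lam (k + 1) • F (zs (k + 1)))
    : ∀ T : ℕ, 1 ≤ T → ∀ zt : Wp m n,
      zt = (∑ k ∈ Finset.Icc 1 T, lam k)⁻¹ • ∑ k ∈ Finset.Icc 1 T, lam k • zs k →
      sSup ((fun b => f (pmk (pfst zt) b)) ''
          Metric.closedBall ystar (5 * ‖zs 0 - pmk xstar ystar‖))
        - sInf ((fun a => f (pmk a (psnd zt))) ''
          Metric.closedBall xstar (5 * ‖zs 0 - pmk xstar ystar‖)) ≤
        1152 * Real.sqrt 2 * L * ‖zs 0 - pmk xstar ystar‖ ^ 3 / (T : ℝ) ^ ((3 : ℝ) / 2)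
          + 576 * Real.sqrt 2 * δ * ‖zs 0 - pmk xstar ystar‖ ^ 2 / (T : ℝ) := by
  intro T hT zt hzt
  set D := ‖zs 0 - pmk xstar ystar‖ with hDdef
  have hD : 0 ≤ D := norm_nonneg _
  have hd : Differentiable ℝ f := hf.differentiable (by norm_num)
  refine csSup_sub_csInf_le ((Metric.nonempty_closedBall.2 (by positivity)).image _)
    ((Metric.nonempty_closedBall.2 (by positivity)).image _) ?_
  rintro _ ⟨b, hb, rfl⟩ _ ⟨a, ha, rfl⟩
  rw [mem_closedBall_iff_norm] at ha hb
  rcases subsingleton_or_nontrivial (Wp m n) with hsing | hnon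
  · have h1 : D = 0 := by rw [hDdef, Subsingleton.elim (zs 0) (pmk xstar ystar), sub_self, norm_zero]
    simp [h1, Subsingleton.elim (pmk (pfst zt) b) (pmk a (psnd zt))]
  have hL : 0 ≤ L := by
    obtain ⟨z, w, hzw⟩ := exists_pair_ne (Wp m n)
    exact nonneg_of_mul_nonneg_left
      ((norm_nonneg (fderiv ℝ (fderiv ℝ f) z - fderiv ℝ (fderiv ℝ f) w)).trans (hhess z w))
      (norm_pos_iff.2 (sub_ne_zero.2 hzw))
  have hδ : 0 ≤ δ := (norm_nonneg _).trans (hJ 0)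
  have hLip := norm_sub_le_of_hessian_lipschitz hf hFdef hhess hF'
  have hstep : ∀ k, ‖lam (k + 1) • F (zs (k + 1)) + (zs (k + 1) - vs (k + 1))‖
      ≤ 13 / 16 * ‖zs (k + 1) - vs (k + 1)‖ := fun k => by
    set d := zs (k + 1) - vs (k + 1) with hdd
    refine norm_smul_add_le_of_model (Fv := F (vs (k + 1))) (Jd := J (vs (k + 1)) d)
      hL (hlampos _) (hlam k).1 (hlam k).2 ?_ ?_
    · have h1 := norm_sub_sub_fderiv_le_of_lipschitz_s18 hF' hLip (vs (k + 1)) (zs (k + 1))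
      have h2 := (F' (vs (k + 1)) - J (vs (k + 1))).le_of_opNorm_le (hJ _) d
      have h3 : F (zs (k + 1)) - F (vs (k + 1)) - J (vs (k + 1)) d
          = (F (zs (k + 1)) - F (vs (k + 1)) - F' (vs (k + 1)) d)
            + (F' (vs (k + 1)) - J (vs (k + 1))) d := by
        rw [sub_apply]; abel
      rw [h3]
      exact (norm_add_le _ _).trans (add_le_add h1 h2)
    · rw [← hΩ]
      have h1 : 0 ≤ L / 2 * ‖d‖ ^ 2 + δ * ‖d‖ := by positivity
      calc _ ≤ _ := hsub k
        _ ≤ τ * (L / 2 * ‖d‖ ^ 2 + δ * ‖d‖) :=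
          mul_le_mul_of_nonneg_left (min_le_left _ _) hτ0.le
        _ ≤ _ := mul_le_of_le_one_left h1 hτ1.le
  have hregret := sum_mul_inner_add_le_of_contracting (G := fun k => F (zs k)) hs0 hvrec hsrec hstep
  have hgap := sub_le_inner_saddleOperator hd hconv hconc hFdef
  have hr : ∑ k ∈ Finset.Icc 1 T, ‖zs k - vs k‖ ^ 2 ≤ 4 * D ^ 2 := by
    have h1 := hregret (pmk xstar ystar) T
    have h2 : 0 ≤ ∑ k ∈ Finset.Icc 1 T, lam k * ⟪F (zs k), zs k - pmk xstar ystar⟫ :=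
      Finset.sum_nonneg fun k _ => mul_nonneg (hlampos k).le (by
        linarith [hgap (zs k) xstar ystar, (hsaddle (pfst (zs k)) (psnd (zs k))).1,
          (hsaddle (pfst (zs k)) (psnd (zs k))).2])
    have h3 := sq_nonneg ‖zs 0 + s T - pmk xstar ystar‖
    rw [← hDdef] at h1
    linarith
  have hTpos : (0 : ℝ) < T := by exact_mod_cast hT
  have hstepsize : ∀ k ∈ Finset.Icc 1 T, 1 / 16 ≤ lam k * (L * ‖zs k - vs k‖ + δ) := fun k hk => by
    obtain ⟨j, rfl⟩ := Nat.exists_eq_add_of_le' (Finset.mem_Icc.1 hk).1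
    exact (hlam j).1
  have hsize := sq_le_sum_step_mul hL hD (fun k _ => hlampos k) hstepsize hr
  have hΛ : 0 < ∑ k ∈ Finset.Icc 1 T, lam k :=
    Finset.sum_pos (fun k _ => hlampos k) (Finset.nonempty_Icc.2 hT)
  have hdist : ‖zs 0 - pmk a b‖ ^ 2 ≤ 72 * D ^ 2 := by
    have h0 : D ^ 2 = ‖pfst (zs 0) - xstar‖ ^ 2 + ‖psnd (zs 0) - ystar‖ ^ 2 :=
      norm_sq_eq_pfst_psnd _
    have h1 : ‖zs 0 - pmk a b‖ ^ 2 = ‖pfst (zs 0) - a‖ ^ 2 + ‖psnd (zs 0) - b‖ ^ 2 :=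
      norm_sq_eq_pfst_psnd _
    have hx : ‖pfst (zs 0) - xstar‖ ≤ D :=
      (abs_le_of_sq_le_sq' (by linarith [sq_nonneg ‖psnd (zs 0) - ystar‖]) hD).2
    have hy : ‖psnd (zs 0) - ystar‖ ≤ D :=
      (abs_le_of_sq_le_sq' (by linarith [sq_nonneg ‖pfst (zs 0) - xstar‖]) hD).2
    have hxa : ‖pfst (zs 0) - a‖ ≤ 6 * D := by
      have := norm_sub_le_norm_sub_add_norm_sub (pfst (zs 0)) xstar a
      rw [norm_sub_rev xstar a] at this
      linarith
    have hyb : ‖psnd (zs 0) - b‖ ≤ 6 * D := by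
      have := norm_sub_le_norm_sub_add_norm_sub (psnd (zs 0)) ystar b
      rw [norm_sub_rev ystar b] at this
      linarith
    have h2 := pow_le_pow_left₀ (norm_nonneg _) hxa 2
    have h3 := pow_le_pow_left₀ (norm_nonneg _) hyb 2
    rw [h1]
    linarith
  have hsum : ∑ k ∈ Finset.Icc 1 T, lam k * (f (pmk (pfst (zs k)) b) - f (pmk a (psnd (zs k))))
      ≤ 36 * D ^ 2 := by
    have h1 := hregret (pmk a b) T
    have h2 := Finset.sum_le_sum (s := Finset.Icc 1 T) fun k _ =>
      mul_le_mul_of_nonneg_left (hgap (zs k) a b) (hlampos k).le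
    have h3 : 0 ≤ ∑ k ∈ Finset.Icc 1 T, ‖zs k - vs k‖ ^ 2 :=
      Finset.sum_nonneg fun _ _ => by positivity
    have h4 := sq_nonneg ‖zs 0 + s T - pmk a b‖
    linarith
  have hinv : (∑ k ∈ Finset.Icc 1 T, lam k)⁻¹ ≤ 16 * (2 * L * D * √T + δ * T) / T ^ 2 := by
    rw [inv_le_iff_one_le_mul₀ hΛ, div_mul_eq_mul_div, one_le_div (by positivity)]
    linarith
  have hpow : (T : ℝ) ^ ((3 : ℝ) / 2) * √T = T ^ 2 := by
    rw [Real.sqrt_eq_rpow, ← Real.rpow_add hTpos, ← Real.rpow_natCast]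
    norm_num
  have hsqrt : √(T : ℝ) / T ^ 2 = 1 / (T : ℝ) ^ ((3 : ℝ) / 2) := by
    rw [← hpow]
    have := Real.sqrt_pos.2 hTpos
    field_simp
  have h2 : 1 ≤ √(2 : ℝ) := Real.one_le_sqrt.2 one_le_two
  rw [hzt]
  calc _ ≤ _ := sub_weighted_average_le hconv hconc (fun k _ => (hlampos k).le) hΛ zs a b
    _ ≤ (∑ k ∈ Finset.Icc 1 T, lam k)⁻¹ * (36 * D ^ 2) :=
      mul_le_mul_of_nonneg_left hsum (inv_nonneg.2 hΛ.le)
    _ ≤ 16 * (2 * L * D * √T + δ * T) / T ^ 2 * (36 * D ^ 2) :=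
      mul_le_mul_of_nonneg_right hinv (by positivity)
    _ = 1152 * 1 * L * D ^ 3 * (√T / T ^ 2) + 576 * 1 * δ * D ^ 2 / T := by
      field_simp
      ring
    _ ≤ _ := by
      rw [hsqrt, mul_one_div]
      gcongr
end
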